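/- Let N ≥ 3 be odd, q ∈ ℂ a primitive N-th root of unity, and let X, Z be invertible N×N complex matrices with Z·X = q·X·Z and X^N = Z^N = 1. Fix an integer M ≥ 1 and let H := (ℂ²)^{⊗M}. Let x_r, y_r, μ_r, x_s, y_s, μ_s, κ₀, κ₁, w ∈ ℂ, U_r(w) := [[w, κ₀ x_r μ_r],[κ₁ y_r, w μ_r]], V_s(w) := [[−qw, κ₀ y_s],[q κ₁ x_s μ_s, −w μ_s]], and for 2×2 complex matrices A, B set {A,B} := diag(X⁻¹,1)·A·diag(Z⁻¹,Z)·B·diag(X,1) ∈ End(ℂ^N ⊗ ℂ²). Define the four L-operators L_Ω(w) := {U_r(w), V_s(w)}, L_φ := {1₂, 1₂}, L_ρ(w) := {U_r(w), 1₂}, L_ρ̄(w) := {V_s(w), 1₂}. For any L ∈ End(ℂ^N ⊗ ℂ²), regarded as an N×N matrix over M₂(ℂ) with the ℂ^N (auxiliary) indices outside, let L^{(i)} ∈ M_N(End(H)) be the matrix whose 2×2-matrix entries act at site i of H, and define the transfer operator 𝒯[L] := trace of L^{(M)}·⋯·L^{(1)} in M_N(End(H)). Then 𝒯[L_Ω(w)]·𝒯[L_φ]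 = 𝒯[L_ρ(w)]·𝒯[L_ρ̄(w)] in End(H). -/

import Mathlib

open Matrix Kronecker

noncomputable section

/-- `E₀₀`, the elementary 2×2 matrix picking out the first component. -/
def E00 : Matrix (Fin 2) (Fin 2) ℂ := !![1, 0; 0, 0]

/-- `E₁₁`, the elementary 2×2 matrix picking out the second component. -/
def E11 : Matrix (Fin 2) (Fin 2) ℂ := !![0, 0; 0, 1]

/-- The bracket `{A,B} = diag(X⁻¹,1)·A·diag(Z⁻¹,Z)·B·diag(X,1)` of (eq:ABnotn). -/
def bra {m : Type*} [Fintype m] [DecidableEq m] (X Z : Matrix m m ℂ)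
    (A B : Matrix (Fin 2) (Fin 2) ℂ) : Matrix (m × Fin 2) (m × Fin 2) ℂ :=
  (X⁻¹ ⊗ₖ E00 + (1 : Matrix m m ℂ) ⊗ₖ E11) * ((1 : Matrix m m ℂ) ⊗ₖ A) *
    (Z⁻¹ ⊗ₖ E00 + Z ⊗ₖ E11) * ((1 : Matrix m m ℂ) ⊗ₖ B) *
    (X ⊗ₖ E00 + (1 : Matrix m m ℂ) ⊗ₖ E11)

/-- A 2×2 matrix `m` acting at site `i` of the chain `H = (ℂ²)^{⊗M}`. -/
def siteOp (M : ℕ) (i : Fin M) (m : Matrix (Fin 2) (Fin 2) ℂ) :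
    Matrix (Fin M → Fin 2) (Fin M → Fin 2) ℂ :=
  Matrix.of fun f g => m (f i) (g i) * (if ∀ j, j ≠ i → f j = g j then 1 else 0)

/-- An operator on `ℂ^K ⊗ ℂ²` regarded as a `K×K` matrix over `M₂(ℂ)`
(auxiliary indices outside). -/
def auxMat (K : Type*) (L : Matrix (K × Fin 2) (K × Fin 2) ℂ) :
    Matrix K K (Matrix (Fin 2) (Fin 2) ℂ) :=
  Matrix.of fun i j => Matrix.of fun a b => L (i, a) (j, b)

/-- The transfer operator `𝒯[L]`: the trace over the auxiliary space of the ordered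
product `L^{(M)} ⋯ L^{(1)}` of the site-wise L-operators. -/
def transfer {K : Type*} [Fintype K] [DecidableEq K] (M : ℕ)
    (Lmat : Matrix K K (Matrix (Fin 2) (Fin 2) ℂ)) :
    Matrix (Fin M → Fin 2) (Fin M → Fin 2) ℂ :=
  Matrix.trace
    (((List.finRange M).reverse.map fun i => Lmat.map fun m => siteOp M i m).prod)

/-! ### One-site operators -/

theorem siteOp_mul_apply (M : ℕ) (i : Fin M) (m : Matrix (Fin 2) (Fin 2) ℂ)
    (B : Matrix (Fin M → Fin 2) (Fin M → Fin 2) ℂ) (f g : Fin M → Fin 2) :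
    (siteOp M i m * B) f g = ∑ c, m (f i) c * B (Function.update f i c) g := by
  rw [Matrix.mul_apply]
  symm
  refine Finset.sum_of_injOn (fun c => Function.update f i c)
    (fun a _ b _ h => by simpa using congrFun h i) (by simp [Set.MapsTo]) ?_ ?_
  · intro h _ hh
    have : ¬ ∀ j, j ≠ i → f j = h j := by
      intro hj
      refine hh ⟨h i, by simp, ?_⟩
      ext j
      by_cases hji : j = i
      · subst hji; simp
      · simp [hji, hj j hji]
    simp [siteOp, this]
  · intro c _
    have : ∀ j, j ≠ i → f j = Function.update f i c j := fun j hj => by simp [hj]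
    simp only [siteOp, Matrix.of_apply, Function.update_self, if_pos this, mul_one]

theorem siteOp_mul (M : ℕ) (i : Fin M) (m n : Matrix (Fin 2) (Fin 2) ℂ) :
    siteOp M i (m * n) = siteOp M i m * siteOp M i n := by
  ext f g
  rw [siteOp_mul_apply]
  have (c : Fin 2) : (∀ j, j ≠ i → Function.update f i c j = g j) ↔ ∀ j, j ≠ i → f j = g j :=
    forall₂_congr fun j hj => by simp [hj]
  simp only [siteOp, Matrix.of_apply, this, Function.update_self, Matrix.mul_apply, Finset.sum_mul,
    mul_assoc]

theorem siteOp_mul_siteOp_apply (M : ℕ) {i j : Fin M} (hij : i ≠ j)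
    (m n : Matrix (Fin 2) (Fin 2) ℂ) (f g : Fin M → Fin 2) :
    (siteOp M i m * siteOp M j n) f g =
      m (f i) (g i) * n (f j) (g j) * if ∀ k, k ≠ i → k ≠ j → f k = g k then 1 else 0 := by
  rw [siteOp_mul_apply, Finset.sum_eq_single (g i)]
  · have : (∀ k, k ≠ j → Function.update f i (g i) k = g k) ↔
        ∀ k, k ≠ i → k ≠ j → f k = g k := by
      refine forall_congr' fun k => ?_
      by_cases hk : k = i
      · subst hk; simp
      · simp [hk]
    simp only [siteOp, Matrix.of_apply, this, Function.update_of_ne hij.symm, mul_assoc]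
  · intro c _ hc
    have : ¬ ∀ k, k ≠ j → Function.update f i c k = g k := fun h => hc (by simpa using h i hij)
    simp only [siteOp, Matrix.of_apply, this, if_false, mul_zero]
  · simp

theorem siteOp_commute (M : ℕ) {i j : Fin M} (hij : i ≠ j) (m n : Matrix (Fin 2) (Fin 2) ℂ) :
    Commute (siteOp M i m) (siteOp M j n) := by
  ext f g
  rw [siteOp_mul_siteOp_apply M hij, siteOp_mul_siteOp_apply M hij.symm]
  have : (∀ k, k ≠ i → k ≠ j → f k = g k) ↔ ∀ k, k ≠ j → k ≠ i → f k = g k :=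
    forall_congr' fun k => ⟨fun h a b => h b a, fun h a b => h b a⟩
  simp only [this]
  ring

/-- `siteOp M i` as an algebra homomorphism. -/
def siteHom (M : ℕ) (i : Fin M) :
    Matrix (Fin 2) (Fin 2) ℂ →ₐ[ℂ] Matrix (Fin M → Fin 2) (Fin M → Fin 2) ℂ :=
  AlgHom.ofLinearMap
    { toFun := siteOp M i
      map_add' := fun m n => by
        ext f g
        simp only [siteOp, Matrix.of_apply, Matrix.add_apply, add_mul]
      map_smul' := fun c m => by ext f g; simp [siteOp] }
    (by
      ext f g
      have : f = g ↔ f i = g i ∧ ∀ j, j ≠ i → f j = g j := by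
        refine ⟨fun h => by simp [h], fun h => funext fun j => ?_⟩
        by_cases hj : j = i
        · rw [hj, h.1]
        · exact h.2 j hj
      simp only [LinearMap.coe_mk, AddHom.coe_mk, siteOp, Matrix.of_apply, Matrix.one_apply, this]
      split_ifs <;> simp_all)
    (siteOp_mul M i)

/-! ### Kronecker products over a noncommutative ring -/

section Kronecker

variable {E K ι : Type*} [Ring E] [Fintype K]

theorem mul_kronecker_mul_of_commute {A P B Q : Matrix K K E}
    (h : ∀ i j k l, Commute (P i j) (B k l)) : (A * P) ⊗ₖ (B * Q) = (A ⊗ₖ B) * (P ⊗ₖ Q) := by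
  ext ⟨i, k⟩ ⟨j, l⟩
  simp only [Matrix.kronecker_apply, Matrix.mul_apply, Finset.sum_mul_sum, Fintype.sum_prod_type]
  refine Finset.sum_congr rfl fun m _ => Finset.sum_congr rfl fun n _ => ?_
  rw [mul_assoc, ← mul_assoc (P m j), (h m j k n).eq]
  simp only [mul_assoc]

theorem commute_list_prod_apply [DecidableEq K] {L : ι → Matrix K K E} {e : E} (l : List ι)
    (h : ∀ i ∈ l, ∀ a b, Commute (L i a b) e) (a b : K) : Commute ((l.map L).prod a b) e := by
  induction l generalizing a b with
  | nil =>
    rw [List.map_nil, List.prod_nil, Matrix.one_apply]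
    split_ifs
    · exact Commute.one_left e
    · exact Commute.zero_left e
  | cons i l ih =>
    rw [List.map_cons, List.prod_cons, Matrix.mul_apply]
    refine Commute.sum_left _ _ _ fun c _ => Commute.mul_left (h i (by simp) a c) (ih ?_ c b)
    exact fun j hj => h j (by simp [hj])

theorem list_prod_kronecker_list_prod [DecidableEq K] {L L' : ι → Matrix K K E}
    (h : ∀ i j, i ≠ j → ∀ a b c d, Commute (L i a b) (L' j c d)) {l : List ι} (hl : l.Nodup) :
    (l.map L).prod ⊗ₖ (l.map L').prod = (l.map fun i => L i ⊗ₖ L' i).prod := by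
  induction l with
  | nil =>
    ext ⟨i, k⟩ ⟨j, l⟩
    by_cases h₁ : i = j <;> by_cases h₂ : k = l <;> simp [h₁, h₂]
  | cons i l ih =>
    rw [List.nodup_cons] at hl
    simp only [List.map_cons, List.prod_cons]
    rw [mul_kronecker_mul_of_commute, ih hl.2]
    intro a b c d
    exact commute_list_prod_apply l
      (fun j hj x y => h j i (fun hji => hl.1 (hji ▸ hj)) x y c d) a b

theorem trace_mul_trace_eq_trace_kronecker (A B : Matrix K K E) :
    A.trace * B.trace = (A ⊗ₖ B).trace := by
  simp [Matrix.trace, Finset.sum_mul_sum, Fintype.sum_prod_type]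

end Kronecker

theorem trace_mul_map_algebraMap {R E n : Type*} [CommRing R] [Ring E] [Algebra R E] [Fintype n]
    (A : Matrix n n E) (S : Matrix n n R) :
    (A * S.map (algebraMap R E)).trace = (S.map (algebraMap R E) * A).trace := by
  simp only [Matrix.trace, Matrix.diag_apply, Matrix.mul_apply, Matrix.map_apply]
  rw [Finset.sum_comm]
  exact Finset.sum_congr rfl fun i _ => Finset.sum_congr rfl fun j _ => (Algebra.commutes _ _).symm

theorem transfer_mul_transfer {K : Type*} [Fintype K] [DecidableEq K] (M : ℕ)
    (L L' : Matrix K K (Matrix (Fin 2) (Fin 2) ℂ)) :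
    transfer M L * transfer M L' = transfer M (L ⊗ₖ L') := by
  rw [transfer, transfer, trace_mul_trace_eq_trace_kronecker, list_prod_kronecker_list_prod _
    (List.nodup_reverse.mpr (List.nodup_finRange M)), transfer]
  · congr 4
    ext i ⟨a, b⟩ ⟨c, d⟩
    simp [siteOp_mul]
  · intro i j hij a b c d
    exact siteOp_commute M hij _ _

/-- Transfer operators of L-operators conjugate by a scalar auxiliary matrix agree. -/
theorem transfer_eq_of_intertwine {K : Type*} [Fintype K] [DecidableEq K] (M : ℕ)
    {L L' : Matrix K K (Matrix (Fin 2) (Fin 2) ℂ)} {S : Matrix K K ℂ} (hS : IsUnit S)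
    (h : S.map (algebraMap ℂ (Matrix (Fin 2) (Fin 2) ℂ)) * L =
      L' * S.map (algebraMap ℂ (Matrix (Fin 2) (Fin 2) ℂ))) :
    transfer M L = transfer M L' := by
  obtain ⟨⟨S, T, hST, hTS⟩, rfl⟩ := hS
  set E := Matrix (Fin M → Fin 2) (Fin M → Fin 2) ℂ
  have hsite (i : Fin M) : S.map (algebraMap ℂ E) * (L.map fun m => siteOp M i m) =
      (L'.map fun m => siteOp M i m) * S.map (algebraMap ℂ E) := by
    have := congrArg (fun A => A.map (siteHom M i)) h
    simp only [Matrix.map_mul, Matrix.map_map] at this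
    have e : (siteHom M i : _ → E) ∘ algebraMap ℂ (Matrix (Fin 2) (Fin 2) ℂ) = algebraMap ℂ E :=
      funext fun c => (siteHom M i).commutes c
    rw [e] at this
    exact this
  have hprod (l : List (Fin M)) :
      S.map (algebraMap ℂ E) * (l.map fun i => L.map fun m => siteOp M i m).prod =
      (l.map fun i => L'.map fun m => siteOp M i m).prod * S.map (algebraMap ℂ E) := by
    induction l with
    | nil => simp
    | cons i l ih =>
      simp only [List.map_cons, List.prod_cons]
      rw [← mul_assoc, hsite, mul_assoc, ih, mul_assoc]
  have hST' : S.map (algebraMap ℂ E) * T.map (algebraMap ℂ E) = 1 := by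
    rw [← Matrix.map_mul, hST]; simp
  have hTS' : T.map (algebraMap ℂ E) * S.map (algebraMap ℂ E) = 1 := by
    rw [← Matrix.map_mul, hTS]; simp
  set l := (List.finRange M).reverse
  change Matrix.trace _ = Matrix.trace _
  rw [← mul_one (l.map fun i => L'.map fun m => siteOp M i m).prod, ← hST', ← mul_assoc,
    ← hprod, trace_mul_map_algebraMap, ← mul_assoc, hTS', one_mul]

/-! ### The intertwiner -/

section Gaussian

variable {A : Type*} [Ring A] [Algebra ℂ A] {N : ℕ} {q : ℂ} {u w : A}

/-- The Gaussian sum `∑ⱼ q^(-j²) uʲ`. -/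
def gaussian (N : ℕ) (q : ℂ) (u : A) : A := ∑ j ∈ Finset.range N, (q⁻¹ ^ j ^ 2) • u ^ j

theorem sum_range_add_eq_sum_range {B : Type*} [AddCommGroup B] {f : ℕ → B}
    (h : ∀ j, f (j + N) = f j) (d : ℕ) :
    ∑ j ∈ Finset.range N, f (j + d) = ∑ j ∈ Finset.range N, f j := by
  induction d with
  | zero => simp
  | succ d ih =>
    have := Finset.sum_range_succ' (fun j => f (j + d)) N
    rw [Finset.sum_range_succ, add_comm N d, h d, zero_add] at this
    rw [← ih, add_right_cancel this]
    simp only [add_assoc, add_comm 1]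

theorem gaussian_term_periodic (hq : q ^ N = 1) (hu : u ^ N = 1) (j : ℕ) :
    (q ^ (j + N) ^ 2) • u ^ (j + N) = (q ^ j ^ 2) • u ^ j := by
  rw [pow_add u, hu, mul_one, show (j + N) ^ 2 = j ^ 2 + N * (2 * j + N) by ring, pow_add,
    pow_mul q N, hq, one_pow, mul_one]

theorem commute_gaussian {v : A} (h : Commute v u) : Commute v (gaussian N q u) :=
  Commute.sum_right _ _ _ fun j _ => (h.pow_right j).smul_right _

theorem mul_pow_of_mul_eq_smul {c : ℂ} (h : w * u = c • (u * w)) (j : ℕ) :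
    w * u ^ j = c ^ j • (u ^ j * w) := by
  induction j with
  | zero => simp
  | succ j ih =>
    rw [pow_succ, ← mul_assoc, ih, smul_mul_assoc, mul_assoc, h, mul_smul_comm, smul_smul,
      ← mul_assoc, ← pow_succ, ← pow_succ]

theorem gaussian_mul (hq : q ^ N = 1) (hu : u ^ N = 1) (h : w * u = (q⁻¹ ^ 2) • (u * w)) :
    gaussian N q u * w = q⁻¹ • (u * w * gaussian N q u) := by
  have hper := sum_range_add_eq_sum_range
    (f := fun j => (q⁻¹ ^ j ^ 2) • u ^ j)
    (gaussian_term_periodic (q := q⁻¹) (by rw [inv_pow, hq, inv_one]) hu) 1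
  nth_rw 1 [gaussian]
  rw [← hper, Finset.sum_mul, gaussian, Finset.mul_sum, Finset.smul_sum]
  refine Finset.sum_congr rfl fun j _ => ?_
  rw [mul_smul_comm, mul_assoc, mul_pow_of_mul_eq_smul h, mul_smul_comm, smul_smul, smul_smul,
    ← mul_assoc, smul_mul_assoc, pow_succ' u]
  congr 1
  ring

theorem gaussian_mul_gaussian_inv (hN : 0 < N) (hodd : Odd N) (hq : IsPrimitiveRoot q N)
    (hu : u ^ N = 1) : gaussian N q u * gaussian N q⁻¹ u = (N : ℂ) • 1 := by
  have hq0 : q ≠ 0 := hq.ne_zero hN.ne'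
  have hqn : q ^ (N - 1) = q⁻¹ := by
    refine eq_inv_of_mul_eq_one_left ?_
    rw [← pow_succ, Nat.sub_add_cancel hN, hq.pow_eq_one]
  have hcoef (j k : ℕ) :
      q⁻¹ ^ j ^ 2 * q ^ (k + (N - 1) * j) ^ 2 = q ^ k ^ 2 * (q⁻¹ ^ (2 * k)) ^ j := by
    have e : (k + (N - 1) * j) ^ 2 =
        k ^ 2 + ((N - 1) * (2 * k * j) + (N - 1) * ((N - 1) * j ^ 2)) := by ring
    rw [e, pow_add, pow_add, pow_mul q (N - 1), pow_mul q (N - 1), hqn, pow_mul q⁻¹ (N - 1),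
      inv_pow q (N - 1), hqn, inv_inv, pow_mul q⁻¹ (2 * k)]
    have : q⁻¹ ^ j ^ 2 * q ^ j ^ 2 = 1 := by rw [← mul_pow, inv_mul_cancel₀ hq0, one_pow]
    linear_combination (q ^ k ^ 2 * (q⁻¹ ^ (2 * k)) ^ j) * this
  have hgeom (k : ℕ) (hk : k ∈ Finset.range N) :
      ∑ j ∈ Finset.range N, (q⁻¹ ^ (2 * k)) ^ j = if k = 0 then (N : ℂ) else 0 := by
    split_ifs with h0
    · simp [h0]
    · have h1 : q⁻¹ ^ (2 * k) ≠ 1 := by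
        intro h
        rw [hq.inv.pow_eq_one_iff_dvd] at h
        have := Nat.Coprime.dvd_of_dvd_mul_left hodd.coprime_two_right h
        exact absurd (Nat.le_of_dvd (Nat.pos_of_ne_zero h0) this)
          (not_le.mpr (Finset.mem_range.mp hk))
      rw [geom_sum_eq h1, ← pow_mul, mul_comm, pow_mul, inv_pow, hq.pow_eq_one]
      simp
  have hterm (j : ℕ) : (q⁻¹ ^ j ^ 2) • u ^ j * gaussian N q⁻¹ u =
      ∑ k ∈ Finset.range N, (q ^ k ^ 2 * (q⁻¹ ^ (2 * k)) ^ j) • u ^ k := by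
    rw [gaussian, inv_inv,
      ← sum_range_add_eq_sum_range (f := fun k => (q ^ k ^ 2) • u ^ k)
        (gaussian_term_periodic hq.pow_eq_one hu) ((N - 1) * j),
      Finset.mul_sum]
    refine Finset.sum_congr rfl fun k _ => ?_
    rw [mul_smul_comm, smul_mul_assoc, smul_smul, mul_comm (q ^ _), hcoef, ← pow_add]
    congr 1
    have e : j + (k + (N - 1) * j) = k + N * j := by
      obtain ⟨n, rfl⟩ := Nat.exists_eq_add_of_lt hN
      simp only [zero_add, Nat.add_sub_cancel]
      ring
    rw [e, pow_add, pow_mul u N, hu, one_pow, mul_one]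
  nth_rw 1 [gaussian]
  rw [Finset.sum_mul, Finset.sum_congr rfl fun j _ => hterm j, Finset.sum_comm]
  have hk (k : ℕ) (hk : k ∈ Finset.range N) :
      ∑ j ∈ Finset.range N, (q ^ k ^ 2 * (q⁻¹ ^ (2 * k)) ^ j) • u ^ k =
        if k = 0 then (N : ℂ) • 1 else 0 := by
    rw [← Finset.sum_smul, ← Finset.mul_sum, hgeom k hk]
    split_ifs with h0 <;> simp [h0]
  rw [Finset.sum_congr rfl hk]
  simp [hN]

theorem isUnit_gaussian (hN : 0 < N) (hodd : Odd N) (hq : IsPrimitiveRoot q N)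
    (hu : u ^ N = 1) : IsUnit (gaussian N q u) := by
  have hc : Commute (gaussian N q u) (gaussian N q⁻¹ u) :=
    commute_gaussian (commute_gaussian (Commute.refl u)).symm
  have h := gaussian_mul_gaussian_inv hN hodd hq hu
  have hN' : IsUnit (gaussian N q u * gaussian N q⁻¹ u) := by
    rw [h, ← Algebra.algebraMap_eq_smul_one]
    exact (IsUnit.mk0 (N : ℂ) (by exact_mod_cast hN.ne')).map _
  exact (hc.isUnit_mul_iff.mp hN').1

end Gaussian

/-! ### The local factorization -/

section Local

variable {K : Type*} [Fintype K]

theorem eq_of_map_apply {n : Type*} {F G : Matrix n n (Matrix (Fin 2) (Fin 2) ℂ)}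
    (h : ∀ a b, F.map (fun m => m a b) = G.map (fun m => m a b)) : F = G := by
  ext i j a b
  exact congrFun₂ (h a b) i j

theorem auxMat_bra_map [DecidableEq K] (X Z : Matrix K K ℂ) (A B : Matrix (Fin 2) (Fin 2) ℂ)
    (a b : Fin 2) : (auxMat K (bra X Z A B)).map (fun m => m a b) =
      ∑ c, (A a c * B c b) • (![X⁻¹, 1] a * ![Z⁻¹, Z] c * ![X, 1] b) := by
  ext i j
  rw [A.eta_fin_two, B.eta_fin_two]
  fin_cases a <;> fin_cases b <;>
  simp [bra, auxMat, E00, E11, add_mul, mul_add, ← Matrix.mul_kronecker_mul,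
    Matrix.kroneckerMap_apply, Fin.sum_univ_two] <;>
  ring

theorem kronecker_map_apply {n : Type*} (L L' : Matrix n n (Matrix (Fin 2) (Fin 2) ℂ))
    (a b : Fin 2) : (L ⊗ₖ L').map (fun m => m a b) =
      ∑ h, L.map (fun m => m a h) ⊗ₖ L'.map (fun m => m h b) := by
  ext ⟨i, k⟩ ⟨j, l⟩
  simp [Matrix.mul_apply, Matrix.sum_apply]

theorem map_algebraMap_mul_map_apply (S : Matrix K K ℂ)
    (F : Matrix K K (Matrix (Fin 2) (Fin 2) ℂ)) (a b : Fin 2) :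
    (S.map (algebraMap ℂ (Matrix (Fin 2) (Fin 2) ℂ)) * F).map (fun m => m a b) =
      S * F.map (fun m => m a b) := by
  ext i j
  simp [Matrix.mul_apply (m := K), Matrix.sum_apply, Matrix.algebraMap_eq_diagonal]

theorem map_mul_map_algebraMap_apply (S : Matrix K K ℂ)
    (F : Matrix K K (Matrix (Fin 2) (Fin 2) ℂ)) (a b : Fin 2) :
    (F * S.map (algebraMap ℂ (Matrix (Fin 2) (Fin 2) ℂ))).map (fun m => m a b) =
      F.map (fun m => m a b) * S := by
  ext i j
  simp [Matrix.mul_apply (m := K), Matrix.sum_apply, Matrix.algebraMap_eq_diagonal]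

variable {N : ℕ} {q : ℂ} {X Z : Matrix K K ℂ}

theorem kronecker_inv_pow_eq_one [DecidableEq K] (hXN : X ^ N = 1) : (X ⊗ₖ X⁻¹) ^ N = 1 := by
  have hpow (n : ℕ) : (X ⊗ₖ X⁻¹) ^ n = (X ^ n) ⊗ₖ (X⁻¹ ^ n) := by
    induction n with
    | zero => simp
    | succ n ih => rw [pow_succ, ih, ← Matrix.mul_kronecker_mul, ← pow_succ, ← pow_succ]
  rw [hpow, hXN, Matrix.inv_pow', hXN, inv_one, Matrix.one_kronecker_one]

theorem gaussian_mul_kronecker [DecidableEq K] (hq0 : q ≠ 0) (hqN : q ^ N = 1)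
    (hXu : IsUnit X) (hZu : IsUnit Z) (hZX : Z * X = q • (X * Z)) (hXN : X ^ N = 1) (b c : Fin 2) :
    gaussian N q (X ⊗ₖ X⁻¹) *
        ((![Z⁻¹, Z] c * ![X, 1] b) ⊗ₖ (![X⁻¹, 1] b * ![Z⁻¹, Z] b)) =
      ((![Z⁻¹, Z] c * ![X, 1] c) ⊗ₖ (![X⁻¹, 1] c * ![Z⁻¹, Z] b)) *
        gaussian N q (X ⊗ₖ X⁻¹) := by
  have hX := (Matrix.isUnit_iff_isUnit_det X).mp hXu
  have hZ := (Matrix.isUnit_iff_isUnit_det Z).mp hZu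
  have hXZ : X * Z = q⁻¹ • (Z * X) := by rw [hZX, smul_smul, inv_mul_cancel₀ hq0, one_smul]
  have hZiX : Z⁻¹ * X = q⁻¹ • (X * Z⁻¹) := by
    calc Z⁻¹ * X = Z⁻¹ * (X * Z) * Z⁻¹ := by
          rw [mul_assoc, mul_assoc, Matrix.mul_nonsing_inv _ hZ, mul_one]
      _ = q⁻¹ • (X * Z⁻¹) := by
          rw [hXZ, mul_smul_comm, ← mul_assoc, Matrix.nonsing_inv_mul _ hZ, one_mul, smul_mul_assoc]
  have hZXi : Z * X⁻¹ = q⁻¹ • (X⁻¹ * Z) := by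
    calc Z * X⁻¹ = X⁻¹ * (X * Z) * X⁻¹ := by
          rw [← mul_assoc, Matrix.nonsing_inv_mul _ hX, one_mul]
      _ = q⁻¹ • (X⁻¹ * Z) := by
          rw [hXZ, mul_smul_comm, smul_mul_assoc, mul_assoc, mul_assoc,
            Matrix.mul_nonsing_inv _ hX, mul_one]
  have hZiXi : Z⁻¹ * X⁻¹ = q • (X⁻¹ * Z⁻¹) := by
    rw [← Matrix.mul_inv_rev, ← Matrix.mul_inv_rev, hXZ]
    rw [Matrix.inv_eq_right_inv]
    rw [smul_mul_smul_comm, inv_mul_cancel₀ hq0, one_smul, Matrix.mul_nonsing_inv _ (by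
      rw [Matrix.det_mul]; exact hZ.mul hX)]
  set u := X ⊗ₖ X⁻¹ with hu
  have huN : u ^ N = 1 := kronecker_inv_pow_eq_one hXN
  have hu0 (V : Matrix K K ℂ) : (Z⁻¹ * X) ⊗ₖ (X⁻¹ * V) = q⁻¹ • (u * (Z⁻¹ ⊗ₖ V)) := by
    rw [hZiX, Matrix.smul_kronecker, Matrix.mul_kronecker_mul]
  have hu1 (V : Matrix K K ℂ) : (Z * X) ⊗ₖ (X⁻¹ * V) = q • (u * (Z ⊗ₖ V)) := by
    rw [hZX, Matrix.smul_kronecker, Matrix.mul_kronecker_mul]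
  have hw := gaussian_mul (w := Z⁻¹ ⊗ₖ Z) hqN huN (by
    rw [hu, ← Matrix.mul_kronecker_mul, ← Matrix.mul_kronecker_mul, hZiX, hZXi,
      Matrix.smul_kronecker, Matrix.kronecker_smul, smul_smul, sq])
  have hdiag (V W : Matrix K K ℂ) (h : Commute (V ⊗ₖ W) u) (c : ℂ) :
      gaussian N q u * c • (u * V ⊗ₖ W) = c • (u * V ⊗ₖ W) * gaussian N q u :=
    (((commute_gaussian (Commute.refl u)).mul_left (commute_gaussian h)).smul_left c).eq.symm
  fin_cases b <;> fin_cases c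
  · simp only [Fin.zero_eta, Matrix.cons_val_zero, hu0]
    refine hdiag _ _ ?_ _
    rw [commute_iff_eq, hu, ← Matrix.mul_kronecker_mul, ← Matrix.mul_kronecker_mul, hZiX, hZiXi,
      Matrix.smul_kronecker, Matrix.kronecker_smul, smul_smul, inv_mul_cancel₀ hq0, one_smul]
  · simp only [Fin.zero_eta, Fin.mk_one, Matrix.cons_val_zero, Matrix.cons_val_one, hu1, mul_one,
      one_mul]
    have h2 : (Z⁻¹ ⊗ₖ Z) * (Z ⊗ₖ Z⁻¹) = 1 := by
      rw [← Matrix.mul_kronecker_mul, Matrix.mul_nonsing_inv _ hZ, Matrix.nonsing_inv_mul _ hZ,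
        Matrix.one_kronecker_one]
    have h3 : (Z ⊗ₖ Z⁻¹) * (u * (Z⁻¹ ⊗ₖ Z)) = (q ^ 2) • u := by
      rw [hu, ← Matrix.mul_kronecker_mul, ← Matrix.mul_kronecker_mul, ← mul_assoc, ← mul_assoc,
        hZX, hZiXi, smul_mul_assoc, smul_mul_assoc, mul_assoc, mul_assoc,
        Matrix.mul_nonsing_inv _ hZ, Matrix.nonsing_inv_mul _ hZ, mul_one, mul_one,
        Matrix.smul_kronecker, Matrix.kronecker_smul, smul_smul, sq]
    have hGu : Commute u (gaussian N q u) := commute_gaussian (Commute.refl u)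
    calc gaussian N q u * q • (u * Z ⊗ₖ Z⁻¹)
        = q⁻¹ • ((q ^ 2) • u * gaussian N q u) * (Z ⊗ₖ Z⁻¹) := by
          rw [smul_mul_assoc, smul_mul_assoc, smul_mul_assoc, smul_smul, mul_smul_comm,
            ← mul_assoc, ← hGu.eq, sq, ← mul_assoc, inv_mul_cancel₀ hq0, one_mul]
      _ = (Z ⊗ₖ Z⁻¹) * (gaussian N q u * (Z⁻¹ ⊗ₖ Z)) * (Z ⊗ₖ Z⁻¹) := by
          rw [← h3, hw, mul_smul_comm]
          simp only [mul_assoc]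
      _ = Z ⊗ₖ Z⁻¹ * gaussian N q u := by rw [mul_assoc, mul_assoc, h2, mul_one]
  · simp only [Fin.zero_eta, Fin.mk_one, Matrix.cons_val_zero, Matrix.cons_val_one, hu0, mul_one,
      one_mul]
    rw [hw, smul_mul_assoc]
  · simp only [Fin.mk_one, Matrix.cons_val_one, Matrix.cons_val_zero, mul_one, one_mul]
    refine (commute_gaussian ?_).eq.symm
    rw [commute_iff_eq, hu, ← Matrix.mul_kronecker_mul, ← Matrix.mul_kronecker_mul, hZX, hZXi,
      Matrix.smul_kronecker, Matrix.kronecker_smul, smul_smul, mul_inv_cancel₀ hq0, one_smul]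

theorem gaussian_mul_auxMat_bra [DecidableEq K] (hq0 : q ≠ 0) (hqN : q ^ N = 1)
    (hXu : IsUnit X) (hZu : IsUnit Z) (hZX : Z * X = q • (X * Z)) (hXN : X ^ N = 1)
    (A B : Matrix (Fin 2) (Fin 2) ℂ) :
    (gaussian N q (X ⊗ₖ X⁻¹)).map (algebraMap ℂ (Matrix (Fin 2) (Fin 2) ℂ)) *
        (auxMat K (bra X Z A B) ⊗ₖ auxMat K (bra X Z 1 1)) =
      (auxMat K (bra X Z A 1) ⊗ₖ auxMat K (bra X Z B 1)) *
        (gaussian N q (X ⊗ₖ X⁻¹)).map (algebraMap ℂ (Matrix (Fin 2) (Fin 2) ℂ)) := by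
  refine eq_of_map_apply fun a b => ?_
  have hX := (Matrix.isUnit_iff_isUnit_det X).mp hXu
  rw [map_algebraMap_mul_map_apply, map_mul_map_algebraMap_apply, kronecker_map_apply,
    kronecker_map_apply]
  simp only [auxMat_bra_map]
  have hXiX : X⁻¹ * X = X * X⁻¹ := by rw [Matrix.nonsing_inv_mul _ hX, Matrix.mul_nonsing_inv _ hX]
  have hleft : Commute ((![X⁻¹, 1] a) ⊗ₖ (1 : Matrix K K ℂ)) (gaussian N q (X ⊗ₖ X⁻¹)) := by
    refine commute_gaussian ?_
    rw [commute_iff_eq, ← Matrix.mul_kronecker_mul, ← Matrix.mul_kronecker_mul]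
    fin_cases a <;> simp [hXiX]
  have hright : Commute ((1 : Matrix K K ℂ) ⊗ₖ (![X, 1] b)) (gaussian N q (X ⊗ₖ X⁻¹)) := by
    refine commute_gaussian ?_
    rw [commute_iff_eq, ← Matrix.mul_kronecker_mul, ← Matrix.mul_kronecker_mul]
    fin_cases b <;> simp [hXiX]
  have hterm (c : Fin 2) : gaussian N q (X ⊗ₖ X⁻¹) * ((![X⁻¹, 1] a * ![Z⁻¹, Z] c * ![X, 1] b) ⊗ₖ
        (![X⁻¹, 1] b * ![Z⁻¹, Z] b * ![X, 1] b)) =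
      ((![X⁻¹, 1] a * ![Z⁻¹, Z] c * ![X, 1] c) ⊗ₖ
        (![X⁻¹, 1] c * ![Z⁻¹, Z] b * ![X, 1] b)) * gaussian N q (X ⊗ₖ X⁻¹) := by
    have hsplit (P Q R T V : Matrix K K ℂ) :
        (P * Q * R) ⊗ₖ (T * V) = (P ⊗ₖ 1) * ((Q * R) ⊗ₖ T) * (1 ⊗ₖ V) := by
      rw [← Matrix.mul_kronecker_mul, ← Matrix.mul_kronecker_mul, one_mul, mul_one, mul_assoc]
    rw [hsplit, hsplit, ← mul_assoc, ← mul_assoc, ← hleft.eq, mul_assoc (_ ⊗ₖ _) (gaussian _ _ _),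
      gaussian_mul_kronecker hq0 hqN hXu hZu hZX hXN, mul_assoc _ (_ ⊗ₖ _) (gaussian _ _ _),
      hright.eq]
    simp only [mul_assoc]
  have hL : ∑ h, (∑ c, (A a c * B c h) • (![X⁻¹, 1] a * ![Z⁻¹, Z] c * ![X, 1] h)) ⊗ₖ
        (∑ c, ((1 : Matrix (Fin 2) (Fin 2) ℂ) h c * (1 : Matrix (Fin 2) (Fin 2) ℂ) c b) •
          (![X⁻¹, 1] h * ![Z⁻¹, Z] c * ![X, 1] b)) =
      ∑ c, (A a c * B c b) • ((![X⁻¹, 1] a * ![Z⁻¹, Z] c * ![X, 1] b) ⊗ₖ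
        (![X⁻¹, 1] b * ![Z⁻¹, Z] b * ![X, 1] b)) := by
    obtain rfl | rfl : b = 0 ∨ b = 1 := by omega
    all_goals simp [Fin.sum_univ_two, Matrix.add_kronecker, Matrix.smul_kronecker]
  have hR : ∑ h, (∑ c, (A a c * (1 : Matrix (Fin 2) (Fin 2) ℂ) c h) •
          (![X⁻¹, 1] a * ![Z⁻¹, Z] c * ![X, 1] h)) ⊗ₖ
        (∑ c, (B h c * (1 : Matrix (Fin 2) (Fin 2) ℂ) c b) •
          (![X⁻¹, 1] h * ![Z⁻¹, Z] c * ![X, 1] b)) =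
      ∑ c, (A a c * B c b) • ((![X⁻¹, 1] a * ![Z⁻¹, Z] c * ![X, 1] c) ⊗ₖ
        (![X⁻¹, 1] c * ![Z⁻¹, Z] b * ![X, 1] b)) := by
    obtain rfl | rfl : b = 0 ∨ b = 1 := by omega
    all_goals
      simp [Fin.sum_univ_two, Matrix.smul_kronecker, Matrix.kronecker_smul, smul_smul, mul_comm]
  rw [hL, hR, Finset.mul_sum, Finset.sum_mul]
  refine Finset.sum_congr rfl fun c _ => ?_
  rw [mul_smul_comm, smul_mul_assoc, hterm]

end Local

/-- Proposition (Tfact) in product form: the transfer-matrix factorization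
`T_{Ω_{rs}}(w)·T_φ = Q_{ρ_r}(w)·Q_{ρ̄_s}(w)`. -/
theorem stmt_19 (N : ℕ) (hN : 3 ≤ N) (hNodd : Odd N)
    (q : ℂ) (hq : IsPrimitiveRoot q N)
    (X Z : Matrix (Fin N) (Fin N) ℂ) (hXu : IsUnit X) (hZu : IsUnit Z)
    (hZX : Z * X = q • (X * Z)) (hXN : X ^ N = 1) (hZN : Z ^ N = 1)
    (M : ℕ) (hM : 1 ≤ M)
    (xr yr μr xs ys μs κ₀ κ₁ w : ℂ) :
    transfer M (auxMat (Fin N)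
        (bra X Z !![w, κ₀ * xr * μr; κ₁ * yr, w * μr]
          !![-(q * w), κ₀ * ys; q * κ₁ * xs * μs, -(w * μs)])) *
      transfer M (auxMat (Fin N) (bra X Z 1 1))
    = transfer M (auxMat (Fin N)
        (bra X Z !![w, κ₀ * xr * μr; κ₁ * yr, w * μr] 1)) *
      transfer M (auxMat (Fin N)
        (bra X Z !![-(q * w), κ₀ * ys; q * κ₁ * xs * μs, -(w * μs)] 1)) := by
  have hN0 : 0 < N := by omega
  rw [transfer_mul_transfer, transfer_mul_transfer]
  exact transfer_eq_of_intertwine M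
    (isUnit_gaussian hN0 hNodd hq (kronecker_inv_pow_eq_one hXN))
    (gaussian_mul_auxMat_bra (hq.ne_zero hN0.ne') hq.pow_eq_one hXu hZu hZX hXN _ _)

end
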